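/- Resolution theorem: for any finite multiset Γ of PL(∨∨) formulas and any PL(∨∨) formula ψ, Γ ⊨ ψ if and only if for each Λ ∈ R(Γ) there is some α ∈ R(ψ) such that Λ ⊨ α. -/

import Mathlib

/-! Basic propositional team logic PL(∨∨): syntax, team semantics,
resolutions, and the sequent calculi GT, G3cp, GT'. -/

/-- Valuations over a countably infinite set of propositional variables (ℕ). -/
abbrev Val : Type := ℕ → Bool

/-- A team is a set of valuations. -/
abbrev Team : Type := Set Val

/-- Formulas; PL(∨∨) formulas are the well-formed (`WF`) ones, in which
negation is applied only to classical formulas. `disj` is the split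
disjunction ∨ and `idisj` the inquisitive disjunction ∨∨. -/
inductive Form : Type where
  | var : ℕ → Form
  | bot : Form
  | neg : Form → Form
  | conj : Form → Form → Form
  | disj : Form → Form → Form
  | idisj : Form → Form → Form

namespace Form

/-- Classical (CPL) formulas: no inquisitive disjunction. -/
def IsClassical : Form → Prop
  | var _ => True
  | bot => True
  | neg α => IsClassical α
  | conj α β => IsClassical α ∧ IsClassical β
  | disj α β => IsClassical α ∧ IsClassical β
  | idisj _ _ => False

/-- Well-formed formulas = formulas of PL(∨∨): negation applies only to
classical formulas. -/
def WF : Form → Prop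
  | var _ => True
  | bot => True
  | neg α => IsClassical α
  | conj φ ψ => WF φ ∧ WF ψ
  | disj φ ψ => WF φ ∧ WF ψ
  | idisj φ ψ => WF φ ∧ WF ψ

/-- Team satisfaction. -/
def Sat : Form → Team → Prop
  | var p, t => ∀ v ∈ t, v p = true
  | bot, t => t = ∅
  | neg α, t => ∀ v ∈ t, ¬ Sat α {v}
  | conj φ ψ, t => Sat φ t ∧ Sat ψ t
  | disj φ ψ, t => ∃ s u : Team, t = s ∪ u ∧ Sat φ s ∧ Sat ψ u
  | idisj φ ψ, t => Sat φ t ∨ Sat ψ t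

/-- Single-valuation (classical) satisfaction, for classical formulas. -/
def CSat : Form → Val → Prop
  | var p, v => v p = true
  | bot, _ => False
  | neg α, v => ¬ CSat α v
  | conj α β, v => CSat α v ∧ CSat β v
  | disj α β, v => CSat α v ∨ CSat β v
  | idisj _ _, _ => False

/-- The set of resolutions of a formula. -/
def res : Form → Set Form
  | var p => {var p}
  | bot => {bot}
  | neg α => Form.neg '' res α
  | conj φ ψ => Set.image2 Form.conj (res φ) (res ψ)
  | disj φ ψ => Set.image2 Form.disj (res φ) (res ψ)
  | idisj φ ψ => res φ ∪ res ψ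

/-- Propositional variables occurring in a formula. -/
def vars : Form → Set ℕ
  | var p => {p}
  | bot => ∅
  | neg α => vars α
  | conj φ ψ => vars φ ∪ vars ψ
  | disj φ ψ => vars φ ∪ vars ψ
  | idisj φ ψ => vars φ ∪ vars ψ

/-- Signed occurrences: `svars φ true` = positively occurring variables,
`svars φ false` = negatively occurring variables. -/
def svars : Form → Bool → Set ℕ
  | var p, b => if b then {p} else ∅
  | bot, _ => ∅
  | neg α, b => svars α (!b)
  | conj φ ψ, b => svars φ b ∪ svars ψ b
  | disj φ ψ, b => svars φ b ∪ svars ψ b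
  | idisj φ ψ, b => svars φ b ∪ svars ψ b

/-- Positively occurring variables P⁺(φ). -/
def pvars (φ : Form) : Set ℕ := φ.svars true

/-- Negatively occurring variables P⁻(φ). -/
def nvars (φ : Form) : Set ℕ := φ.svars false

end Form

/-- `t ⊨ Γ`: every formula of the multiset Γ is satisfied by `t`. -/
def SatAll (t : Team) (Γ : Multiset Form) : Prop := ∀ φ ∈ Γ, Form.Sat φ t

/-- Team entailment Γ ⊨ φ. -/
def Entails (Γ : Multiset Form) (φ : Form) : Prop :=
  ∀ t : Team, SatAll t Γ → Form.Sat φ t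

/-- Resolutions R(Γ) of a multiset of formulas: images of Γ under resolution
functions. -/
def mres (Γ : Multiset Form) : Set (Multiset Form) :=
  {Ξ | ∃ f : Form → Form, (∀ φ ∈ Γ, f φ ∈ Form.res φ) ∧ Ξ = Γ.map f}

/-- Variables occurring in a multiset of formulas. -/
def mvars (Γ : Multiset Form) : Set ℕ := {p | ∃ φ ∈ Γ, p ∈ Form.vars φ}

/-- P⁺(Γ). -/
def mpvars (Γ : Multiset Form) : Set ℕ := {p | ∃ φ ∈ Γ, p ∈ Form.pvars φ}

/-- P⁻(Γ). -/
def mnvars (Γ : Multiset Form) : Set ℕ := {p | ∃ φ ∈ Γ, p ∈ Form.nvars φ}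

/-- The split disjunction ⋁Δ of a multiset (⊥ for the empty multiset).
(Satisfaction is invariant under the order of the chosen list.) -/
noncomputable def bigVee (Δ : Multiset Form) : Form :=
  Δ.toList.foldr Form.disj Form.bot

/-- One-hole formula contexts in which the hole does not occur in the scope
of a negation; these represent the subformula occurrences to which the
deep-inference rules may be applied. -/
inductive Ctx : Type where
  | hole : Ctx
  | conjL : Ctx → Form → Ctx
  | conjR : Form → Ctx → Ctx
  | disjL : Ctx → Form → Ctx
  | disjR : Form → Ctx → Ctx
  | idisjL : Ctx → Form → Ctx
  | idisjR : Form → Ctx → Ctx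

/-- Plugging a formula into a context: χ{η}. -/
def Ctx.fill : Ctx → Form → Form
  | .hole, η => η
  | .conjL c ψ, η => Form.conj (c.fill η) ψ
  | .conjR ψ c, η => Form.conj ψ (c.fill η)
  | .disjL c ψ, η => Form.disj (c.fill η) ψ
  | .disjR ψ c, η => Form.disj ψ (c.fill η)
  | .idisjL c ψ, η => Form.idisj (c.fill η) ψ
  | .idisjR ψ c, η => Form.idisj ψ (c.fill η)

/-- The sequent calculus GT. `GT c n Γ Δ` means: the sequent Γ ⇒ Δ has a
derivation of height at most `n`, using Cut only if `c = true`.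
So `∃ n, GT true n Γ Δ` is derivability in GT, `∃ n, GT false n Γ Δ` is
derivability in the cut-free fragment GT⁻, and `GT false n Γ Δ` is
`⊢ⁿ Γ ⇒ Δ` (cut-free derivability with height at most n). -/
inductive GT : Bool → ℕ → Multiset Form → Multiset Form → Prop
  | ax (c : Bool) (n : ℕ) (Γ Δ : Multiset Form) (p : ℕ) :
      GT c (n + 1) (Form.var p ::ₘ Γ) (Form.var p ::ₘ Δ)
  | lbot (c : Bool) (n : ℕ) (Γ Δ : Multiset Form) :
      GT c (n + 1) (Form.bot ::ₘ Γ) Δ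
  | lneg (c : Bool) (n : ℕ) (Γ Δ : Multiset Form) (α : Form) :
      Form.IsClassical α → GT c n Γ (α ::ₘ Δ) →
      GT c (n + 1) (Form.neg α ::ₘ Γ) Δ
  | rneg (c : Bool) (n : ℕ) (Γ Δ : Multiset Form) (α : Form) :
      Form.IsClassical α → GT c n (α ::ₘ Γ) Δ →
      GT c (n + 1) Γ (Form.neg α ::ₘ Δ)
  | lconj (c : Bool) (n : ℕ) (Γ Δ : Multiset Form) (φ ψ : Form) :
      GT c n (φ ::ₘ ψ ::ₘ Γ) Δ →
      GT c (n + 1) (Form.conj φ ψ ::ₘ Γ) Δ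
  | rconj (c : Bool) (n : ℕ) (Γ Λ Δ : Multiset Form) (φ ψ : Form) :
      (∀ γ ∈ Λ, Form.IsClassical γ) →
      GT c n Γ (φ ::ₘ Λ) → GT c n Γ (ψ ::ₘ Λ) →
      GT c (n + 1) Γ (Form.conj φ ψ ::ₘ (Λ + Δ))
  | ldisj (c : Bool) (n : ℕ) (Γ Λ Δ : Multiset Form) (φ ψ : Form) :
      (∀ γ ∈ Λ, Form.IsClassical γ) →
      GT c n (φ ::ₘ Γ) Λ → GT c n (ψ ::ₘ Γ) Λ →
      GT c (n + 1) (Form.disj φ ψ ::ₘ Γ) (Λ + Δ)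
  | rdisj (c : Bool) (n : ℕ) (Γ Δ : Multiset Form) (φ ψ : Form) :
      GT c n Γ (φ ::ₘ ψ ::ₘ Δ) →
      GT c (n + 1) Γ (Form.disj φ ψ ::ₘ Δ)
  | lidisj (c : Bool) (n : ℕ) (Γ Δ : Multiset Form) (χ : Ctx) (φL φR : Form) :
      GT c n (χ.fill φL ::ₘ Γ) Δ → GT c n (χ.fill φR ::ₘ Γ) Δ →
      GT c (n + 1) (χ.fill (Form.idisj φL φR) ::ₘ Γ) Δ
  | ridisjL (c : Bool) (n : ℕ) (Γ Δ : Multiset Form) (χ : Ctx) (φL φR : Form) :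
      GT c n Γ (χ.fill φL ::ₘ Δ) →
      GT c (n + 1) Γ (χ.fill (Form.idisj φL φR) ::ₘ Δ)
  | ridisjR (c : Bool) (n : ℕ) (Γ Δ : Multiset Form) (χ : Ctx) (φL φR : Form) :
      GT c n Γ (χ.fill φR ::ₘ Δ) →
      GT c (n + 1) Γ (χ.fill (Form.idisj φL φR) ::ₘ Δ)
  | cut (n : ℕ) (Γ Δ Θ S : Multiset Form) (φ : Form) :
      GT true n Γ (φ ::ₘ Δ) → GT true n (φ ::ₘ Θ) S →
      GT true (n + 1) (Γ + Θ) (Δ + S)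

/-- The classical sequent calculus G3cp (on classical formulas).
`G3 false` is its cut-free fragment G3cp⁻. -/
inductive G3 : Bool → Multiset Form → Multiset Form → Prop
  | ax (c : Bool) (Γ Δ : Multiset Form) (p : ℕ) :
      (∀ α ∈ Γ, Form.IsClassical α) → (∀ α ∈ Δ, Form.IsClassical α) →
      G3 c (Form.var p ::ₘ Γ) (Form.var p ::ₘ Δ)
  | lbot (c : Bool) (Γ Δ : Multiset Form) :
      (∀ α ∈ Γ, Form.IsClassical α) → (∀ α ∈ Δ, Form.IsClassical α) →
      G3 c (Form.bot ::ₘ Γ) Δ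
  | lneg (c : Bool) (Γ Δ : Multiset Form) (α : Form) :
      Form.IsClassical α → G3 c Γ (α ::ₘ Δ) → G3 c (Form.neg α ::ₘ Γ) Δ
  | rneg (c : Bool) (Γ Δ : Multiset Form) (α : Form) :
      Form.IsClassical α → G3 c (α ::ₘ Γ) Δ → G3 c Γ (Form.neg α ::ₘ Δ)
  | lconj (c : Bool) (Γ Δ : Multiset Form) (α β : Form) :
      G3 c (α ::ₘ β ::ₘ Γ) Δ → G3 c (Form.conj α β ::ₘ Γ) Δ
  | rconj (c : Bool) (Γ Λ Δ : Multiset Form) (α β : Form) :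
      (∀ γ ∈ Λ, Form.IsClassical γ) → (∀ γ ∈ Δ, Form.IsClassical γ) →
      G3 c Γ (α ::ₘ Λ) → G3 c Γ (β ::ₘ Λ) →
      G3 c Γ (Form.conj α β ::ₘ (Λ + Δ))
  | ldisj (c : Bool) (Γ Λ Δ : Multiset Form) (α β : Form) :
      (∀ γ ∈ Λ, Form.IsClassical γ) → (∀ γ ∈ Δ, Form.IsClassical γ) →
      G3 c (α ::ₘ Γ) Λ → G3 c (β ::ₘ Γ) Λ →
      G3 c (Form.disj α β ::ₘ Γ) (Λ + Δ)
  | rdisj (c : Bool) (Γ Δ : Multiset Form) (α β : Form) :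
      G3 c Γ (α ::ₘ β ::ₘ Δ) → G3 c Γ (Form.disj α β ::ₘ Δ)
  | cut (Γ Δ Θ S : Multiset Form) (α : Form) :
      Form.IsClassical α →
      G3 true Γ (α ::ₘ Δ) → G3 true (α ::ₘ Θ) S →
      G3 true (Γ + Θ) (Δ + S)

/-- The cut-free variant calculus GT'⁻: GT⁻ with independent-context rules
R∧', L∨' in place of R∧, L∨, plus explicit contraction rules LC and RC
(RC restricted to classical formulas). -/
inductive GTp : Multiset Form → Multiset Form → Prop
  | ax (Γ Δ : Multiset Form) (p : ℕ) :
      GTp (Form.var p ::ₘ Γ) (Form.var p ::ₘ Δ)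
  | lbot (Γ Δ : Multiset Form) : GTp (Form.bot ::ₘ Γ) Δ
  | lneg (Γ Δ : Multiset Form) (α : Form) :
      Form.IsClassical α → GTp Γ (α ::ₘ Δ) → GTp (Form.neg α ::ₘ Γ) Δ
  | rneg (Γ Δ : Multiset Form) (α : Form) :
      Form.IsClassical α → GTp (α ::ₘ Γ) Δ → GTp Γ (Form.neg α ::ₘ Δ)
  | lconj (Γ Δ : Multiset Form) (φ ψ : Form) :
      GTp (φ ::ₘ ψ ::ₘ Γ) Δ → GTp (Form.conj φ ψ ::ₘ Γ) Δ
  | rconj (Γ₁ Γ₂ Δ₁ Δ₂ : Multiset Form) (φ ψ : Form) :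
      GTp Γ₁ (φ ::ₘ Δ₁) → GTp Γ₂ (ψ ::ₘ Δ₂) →
      GTp (Γ₁ + Γ₂) (Form.conj φ ψ ::ₘ (Δ₁ + Δ₂))
  | ldisj (Γ₁ Γ₂ Δ₁ Δ₂ : Multiset Form) (φ ψ : Form) :
      GTp (φ ::ₘ Γ₁) Δ₁ → GTp (ψ ::ₘ Γ₂) Δ₂ →
      GTp (Form.disj φ ψ ::ₘ (Γ₁ + Γ₂)) (Δ₁ + Δ₂)
  | rdisj (Γ Δ : Multiset Form) (φ ψ : Form) :
      GTp Γ (φ ::ₘ ψ ::ₘ Δ) → GTp Γ (Form.disj φ ψ ::ₘ Δ)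
  | lidisj (Γ Δ : Multiset Form) (χ : Ctx) (φL φR : Form) :
      GTp (χ.fill φL ::ₘ Γ) Δ → GTp (χ.fill φR ::ₘ Γ) Δ →
      GTp (χ.fill (Form.idisj φL φR) ::ₘ Γ) Δ
  | ridisjL (Γ Δ : Multiset Form) (χ : Ctx) (φL φR : Form) :
      GTp Γ (χ.fill φL ::ₘ Δ) → GTp Γ (χ.fill (Form.idisj φL φR) ::ₘ Δ)
  | ridisjR (Γ Δ : Multiset Form) (χ : Ctx) (φL φR : Form) :
      GTp Γ (χ.fill φR ::ₘ Δ) → GTp Γ (χ.fill (Form.idisj φL φR) ::ₘ Δ)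
  | lc (Γ Δ : Multiset Form) (φ : Form) :
      GTp (φ ::ₘ φ ::ₘ Γ) Δ → GTp (φ ::ₘ Γ) Δ
  | rc (Γ Δ : Multiset Form) (α : Form) :
      Form.IsClassical α → GTp Γ (α ::ₘ α ::ₘ Δ) → GTp Γ (α ::ₘ Δ)

namespace Form

theorem IsClassical.sat_iff {α : Form} (hα : α.IsClassical) (t : Team) :
    Sat α t ↔ ∀ v ∈ t, Sat α {v} := by
  induction α generalizing t with
  | var p => simp [Sat]
  | bot => simp [Sat, Set.eq_empty_iff_forall_notMem]
  | neg α ih => simp [Sat]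
  | conj α β ihα ihβ =>
    simp only [Sat]
    rw [ihα hα.1, ihβ hα.2]
    exact forall₂_and.symm
  | disj α β ihα ihβ =>
    have hα₀ : Sat α ∅ := (ihα hα.1 ∅).2 (by simp)
    have hβ₀ : Sat β ∅ := (ihβ hα.2 ∅).2 (by simp)
    constructor
    · rintro ⟨s, u, rfl, hs, hu⟩ v (hv | hv)
      · exact ⟨{v}, ∅, by simp, (ihα hα.1 s).1 hs v hv, hβ₀⟩
      · exact ⟨∅, {v}, by simp, hα₀, (ihβ hα.2 u).1 hu v hv⟩
    · intro h
      refine ⟨{v ∈ t | Sat α {v}}, {v ∈ t | Sat β {v}}, ?_,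
        (ihα hα.1 _).2 fun v hv => hv.2, (ihβ hα.2 _).2 fun v hv => hv.2⟩
      ext v
      refine ⟨fun hv => ?_, fun hv => hv.elim And.left And.left⟩
      obtain ⟨s, u, hsu, hs, hu⟩ := h v hv
      have hv' : v ∈ s ∪ u := hsu ▸ Set.mem_singleton v
      exact hv'.imp (fun hvs => ⟨hv, (ihα hα.1 s).1 hs v hvs⟩)
        (fun hvu => ⟨hv, (ihβ hα.2 u).1 hu v hvu⟩)
  | idisj α β => exact hα.elim

theorem IsClassical.res_eq {α : Form} (hα : α.IsClassical) : res α = {α} := by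
  induction α with
  | var p => rfl
  | bot => rfl
  | neg α ih => simp [res, ih hα]
  | conj α β ihα ihβ => simp [res, ihα hα.1, ihβ hα.2]
  | disj α β ihα ihβ => simp [res, ihα hα.1, ihβ hα.2]
  | idisj α β => exact hα.elim

theorem WF.isClassical_of_mem_res {φ α : Form} (hφ : φ.WF) (hα : α ∈ res φ) :
    α.IsClassical := by
  induction φ generalizing α with
  | var p => rw [show α = var p from hα]; trivial
  | bot => rw [show α = bot from hα]; trivial
  | neg φ =>
    have hφ' : (neg φ).IsClassical := hφ
    rw [hφ'.res_eq] at hα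
    rwa [show α = neg φ from hα]
  | conj φ ψ ihφ ihψ =>
    obtain ⟨β, hβ, γ, hγ, rfl⟩ := hα
    exact ⟨ihφ hφ.1 hβ, ihψ hφ.2 hγ⟩
  | disj φ ψ ihφ ihψ =>
    obtain ⟨β, hβ, γ, hγ, rfl⟩ := hα
    exact ⟨ihφ hφ.1 hβ, ihψ hφ.2 hγ⟩
  | idisj φ ψ ihφ ihψ => exact hα.elim (ihφ hφ.1) (ihψ hφ.2)

theorem WF.sat_iff_exists_mem_res {φ : Form} (hφ : φ.WF) (t : Team) :
    Sat φ t ↔ ∃ α ∈ res φ, Sat α t := by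
  induction φ generalizing t with
  | var p => simp [res]
  | bot => simp [res]
  | neg φ =>
    have hφ' : (neg φ).IsClassical := hφ
    simp [hφ'.res_eq]
  | conj φ ψ ihφ ihψ =>
    simp only [Sat, res, Set.exists_mem_image2]
    rw [ihφ hφ.1, ihψ hφ.2]
    constructor
    · rintro ⟨⟨α, hα, h⟩, β, hβ, h'⟩
      exact ⟨α, hα, β, hβ, h, h'⟩
    · rintro ⟨α, hα, β, hβ, h, h'⟩
      exact ⟨⟨α, hα, h⟩, β, hβ, h'⟩
  | disj φ ψ ihφ ihψ =>
    simp only [Sat, res, Set.exists_mem_image2]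
    constructor
    · rintro ⟨s, u, rfl, hs, hu⟩
      obtain ⟨α, hα, h⟩ := (ihφ hφ.1 s).1 hs
      obtain ⟨β, hβ, h'⟩ := (ihψ hφ.2 u).1 hu
      exact ⟨α, hα, β, hβ, s, u, rfl, h, h'⟩
    · rintro ⟨α, hα, β, hβ, s, u, rfl, h, h'⟩
      exact ⟨s, u, rfl, (ihφ hφ.1 s).2 ⟨α, hα, h⟩, (ihψ hφ.2 u).2 ⟨β, hβ, h'⟩⟩
  | idisj φ ψ ihφ ihψ =>
    simp only [Sat, res, Set.mem_union, or_and_right, exists_or]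
    rw [ihφ hφ.1, ihψ hφ.2]

end Form

/-- Resolution theorem: Γ ⊨ ψ iff each resolution of Γ entails
some resolution of ψ. -/
theorem resolution_theorem (Γ : Multiset Form) (ψ : Form)
    (hΓ : ∀ φ ∈ Γ, Form.WF φ) (hψ : ψ.WF) :
    Entails Γ ψ ↔ ∀ Λ ∈ mres Γ, ∃ α ∈ Form.res ψ, Entails Λ α := by
  constructor
  · rintro h _ ⟨f, hf, rfl⟩
    have hcl : ∀ φ ∈ Γ, (f φ).IsClassical := fun φ hφ =>
      (hΓ φ hφ).isClassical_of_mem_res (hf φ hφ)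
    -- the largest team satisfying the resolution
    let T : Team := {v | ∀ φ ∈ Γ, Form.Sat (f φ) {v}}
    have hT : SatAll T Γ := fun φ hφ =>
      ((hΓ φ hφ).sat_iff_exists_mem_res T).2
        ⟨f φ, hf φ hφ, ((hcl φ hφ).sat_iff T).2 fun v hv => hv φ hφ⟩
    obtain ⟨α, hα, hαT⟩ := (hψ.sat_iff_exists_mem_res T).1 (h T hT)
    have hαcl := hψ.isClassical_of_mem_res hα
    refine ⟨α, hα, fun t ht => (hαcl.sat_iff t).2 fun v hv => ?_⟩
    exact (hαcl.sat_iff T).1 hαT v fun φ hφ =>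
      ((hcl φ hφ).sat_iff t).1 (ht _ (Multiset.mem_map_of_mem f hφ)) v hv
  · intro h t ht
    have hres : ∀ φ, ∃ α, φ ∈ Γ → α ∈ Form.res φ ∧ Form.Sat α t := by
      intro φ
      by_cases hφ : φ ∈ Γ
      · obtain ⟨α, hα⟩ := ((hΓ φ hφ).sat_iff_exists_mem_res t).1 (ht φ hφ)
        exact ⟨α, fun _ => hα⟩
      · exact ⟨φ, fun hφ' => (hφ hφ').elim⟩
    choose f hf using hres
    obtain ⟨α, hα, hent⟩ := h (Γ.map f) ⟨f, fun φ hφ => (hf φ hφ).1, rfl⟩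
    refine (hψ.sat_iff_exists_mem_res t).2 ⟨α, hα, hent t fun β hβ => ?_⟩
    obtain ⟨φ, hφ, rfl⟩ := Multiset.mem_map.1 hβ
    exact (hf φ hφ).2
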